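/- Let ℓ ≥ 1, κ : Fin ℓ → ℝ with κ_j > 0, R = Σ_j κ_j, and let A, φ, κ', F, F̄_L, S, C be as in the AMoD-to-TAP setting, with (u⁰, κ) ∈ C. Then for every δ ∈ (0, 1] there exists L_δ ∈ (0, ∞) such that for every L > L_δ, every (u*, z*) ∈ C that minimizes F(u) + F̄_L(z) over C satisfies (Σ_j |z*_j − κ_j|)/(2R) ≤ δ. -/

import Mathlib

theorem four_mul_sq_sub_one_le_pow_five {x : ℝ} (hx : 0 ≤ x) :
    4 * (x - 1) ^ 2 ≤ x ^ 5 - 1 - 5 * (x - 1) := by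
  have h : 0 ≤ (x - 1) ^ 2 * (x ^ 3 + 2 * x ^ 2 + 3 * x) := by positivity
  linarith

theorem mul_div_pow_four_ge {k z : ℝ} (hk : 0 < k) (hz : 0 ≤ z) (t : ℝ) :
    k + 5 * (z - k) + 8 * t * |z - k| - 4 * t ^ 2 * k ≤ z * (z / k) ^ 4 := by
  obtain ⟨x, rfl⟩ : ∃ x, z = k * x := ⟨z / k, by field_simp⟩
  have hx : 0 ≤ x := nonneg_of_mul_nonneg_right hz hk
  have h := four_mul_sq_sub_one_le_pow_five hx
  have habs : |k * x - k| = k * |x - 1| := by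
    rw [← mul_sub_one, abs_mul, abs_of_pos hk]
  have key : 1 + 5 * (x - 1) + 8 * t * |x - 1| - 4 * t ^ 2 ≤ x ^ 5 := by
    nlinarith [sq_nonneg (|x - 1| - t), sq_abs (x - 1)]
  rw [habs, mul_div_cancel_left₀ x hk.ne']
  linarith [mul_le_mul_of_nonneg_left key hk.le]

theorem sum_mul_div_pow_four_ge {ι : Type*} [Fintype ι] {k z : ι → ℝ}
    (hk : ∀ j, 0 < k j) (hz : ∀ j, 0 ≤ z j) (hsum : ∑ j, z j = ∑ j, k j) (t : ℝ) :
    ∑ j, k j + 8 * t * ∑ j, |z j - k j| - 4 * t ^ 2 * ∑ j, k j ≤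
      ∑ j, z j * (z j / k j) ^ 4 := by
  have h := Finset.sum_le_sum fun j (_ : j ∈ Finset.univ) =>
    mul_div_pow_four_ge (hk j) (hz j) t
  simp only [Finset.sum_add_distrib, Finset.sum_sub_distrib, ← Finset.mul_sum, hsum] at h
  linarith


/-- Theorem 1 of the paper: in the AMoD-to-TAP setting (with a
fully rebalanced feasible point `(u⁰, κ)`), for every `δ ∈ (0,1]` there exists
`L_δ ∈ (0, ∞)` such that for every `L > L_δ`, every minimizer `(u*, z*)` of
`F(u) + F̄_L(z)` over the feasible set `C` leaves at most a `δ`-fraction of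
rebalancing requests unfulfilled: `(Σ_j |z*_j − κ_j|)/(2R) ≤ δ`. -/
theorem amod_tap_bounded_unfulfilled_fraction
    (ℓ : ℕ) (hℓ : 1 ≤ ℓ) (κ : Fin ℓ → ℝ) (hκ : ∀ j, 0 < κ j)
    (R : ℝ) (hR : R = ∑ j, κ j)
    (A : Type*) [Fintype A] (φ κ' : A → ℝ)
    (hφ : ∀ a, 0 < φ a) (hκ' : ∀ a, 0 < κ' a)
    (F : (A → ℝ) → ℝ)
    (hF : ∀ u : A → ℝ,
      F u = ∑ a, u a * (φ a * (1 + 0.15 * (u a / κ' a) ^ 4)))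
    (Fbar : ℝ → (Fin ℓ → ℝ) → ℝ)
    (hFbar : ∀ (L : ℝ) (z : Fin ℓ → ℝ),
      Fbar L z = ∑ j, z j * (L * (1 + 0.15 * (z j / κ j) ^ 4)))
    (C : Set ((A → ℝ) × (Fin ℓ → ℝ)))
    (hC : ∀ p ∈ C, (∀ a, 0 ≤ p.1 a) ∧ (∀ j, 0 ≤ p.2 j) ∧ (∑ j, p.2 j) = R)
    (u0 : A → ℝ) (hu0 : (u0, κ) ∈ C) :
    ∀ δ ∈ Set.Ioc (0 : ℝ) 1, ∃ Lδ : ℝ, 0 < Lδ ∧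
      ∀ L > Lδ, ∀ p ∈ C,
        (∀ q ∈ C, F p.1 + Fbar L p.2 ≤ F q.1 + Fbar L q.2) →
        (∑ j, |p.2 j - κ j|) / (2 * R) ≤ δ := by
  rintro δ ⟨hδ, -⟩
  have hRpos : 0 < R := by
    rw [hR]
    exact Finset.sum_pos (fun j _ => hκ j) ⟨⟨0, hℓ⟩, Finset.mem_univ _⟩
  have hF_nonneg : ∀ q ∈ C, 0 ≤ F q.1 := fun q hq => by
    rw [hF]
    refine Finset.sum_nonneg fun a _ => ?_
    have := (hC q hq).1 a
    have := hφ a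
    positivity
  have hFbar_eq : ∀ L z, Fbar L z = L * (∑ j, z j + 0.15 * ∑ j, z j * (z j / κ j) ^ 4) := by
    intro L z
    rw [hFbar, Finset.mul_sum, ← Finset.sum_add_distrib, Finset.mul_sum]
    exact Finset.sum_congr rfl fun j _ => by ring
  have hFbar_κ : ∀ L, Fbar L κ = L * (R + 0.15 * R) := by
    intro L
    simp [hFbar_eq, div_self (hκ _).ne', hR]
  have hF0 : 0 ≤ F u0 := hF_nonneg _ hu0
  refine ⟨F u0 / (1.8 * δ ^ 2 * R) + 1, by positivity, fun L hL p hp hmin => ?_⟩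
  obtain ⟨-, hz, hsum⟩ := hC p hp
  have hLF : F u0 < L * (1.8 * δ ^ 2 * R) := by
    rw [← div_lt_iff₀ (by positivity)]
    linarith
  have hLpos : 0 < L := by
    have : 0 ≤ F u0 / (1.8 * δ ^ 2 * R) := by positivity
    linarith
  have hlow := sum_mul_div_pow_four_ge hκ hz (hsum.trans hR) δ
  rw [← hR] at hlow
  have hle := hmin _ hu0
  simp only [hFbar_κ, hFbar_eq L p.2, hsum] at hle
  have hp0 := hF_nonneg p hp
  rw [div_le_iff₀ (by positivity)]
  by_contra! hgt
  have hgap : R + 12 * δ ^ 2 * R ≤ ∑ j, p.2 j * (p.2 j / κ j) ^ 4 := by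
    nlinarith [mul_lt_mul_of_pos_left hgt hδ]
  have := mul_le_mul_of_nonneg_left hgap hLpos.le
  linarith
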